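/- There do not exist pairwise distinct elements α_1, ..., α_5 and pairwise distinct elements β_1, ..., β_5 in GF(17)^× = (Z/17Z)^× such that the product set { α_i β_j : 1 ≤ i, j ≤ 5 } has at most 6 elements. -/

import Mathlib

section SmallProductSets

open Finset
open scoped Pointwise

variable {G : Type*} [CommGroup G] [DecidableEq G] {A B : Finset G} {n : ℕ}

/-- If `A * B` has at most one element more than `B`, then every quotient of elements of `A`
translates `B` to a set missing at most one element of `B`. -/
lemma card_le_card_inter_smul_add_one (hAB : #(A * B) ≤ #B + 1) {t : G} (ht : t ∈ A / A) :
    #B ≤ #(B ∩ t • B) + 1 := by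
  obtain ⟨a, ha, b, hb, rfl⟩ := mem_div.1 ht
  have h_union : #(b • B ∪ a • B) ≤ #(A * B) :=
    card_le_card (union_subset (smul_finset_subset_mul hb) (smul_finset_subset_mul ha))
  have h_inter : #(b • B ∩ a • B) = #(B ∩ (a / b) • B) := by
    rw [card_smul_inter_smul, card_inter_smul, div_eq_inv_mul]
  have h_card := card_union_add_card_inter (b • B) (a • B)
  simp only [card_smul_finset] at h_card
  lia

/-- If `A * B` has at most one element more than `B`, then `A / A` also has at most one
element more than `B`. -/
lemma card_div_self_le (hA : A.Nonempty) (hB : 1 < #B) (hAB : #(A * B) ≤ #B + 1) :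
    #(A / A) ≤ #B + 1 := by
  have h_one : (1 : G) ∈ A / A := one_mem_div_iff.2 fun h ↦ hA.ne_empty (disjoint_self.1 h)
  have h_le : ∑ t ∈ A / A, #(B ∩ t • B) ≤ #B * #B := by
    rw [← card_product]
    simp_rw [card_inter_smul, ← card_div_eq]
    rw [sum_card_fiberwise_eq_card_filter]
    exact card_filter_le _ _
  rw [← add_sum_erase _ _ h_one, one_smul, inter_self] at h_le
  have h_ge : #((A / A).erase 1) * (#B - 1) ≤ ∑ t ∈ (A / A).erase 1, #(B ∩ t • B) := by
    rw [← smul_eq_mul]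
    refine card_nsmul_le_sum _ _ _ fun t ht ↦ ?_
    have := card_le_card_inter_smul_add_one hAB (mem_of_mem_erase ht)
    lia
  rw [card_erase_of_mem h_one] at h_ge
  obtain ⟨m, hm⟩ : ∃ m, #B = m + 1 := ⟨#B - 1, by lia⟩
  simp only [hm, add_tsub_cancel_right] at h_ge h_le ⊢
  have : (#(A / A) - 1) * m ≤ (m + 1) * m := by nlinarith
  have := Nat.le_of_mul_le_mul_right this (by lia)
  lia

/-- If `A / A` has at most one element more than `A` and `A` has at least three elements, then
`A / A` is closed under multiplication. -/
lemma mul_mem_div_self (hA : 2 < #A) (h : #(A / A) ≤ #A + 1) {x y : G}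
    (hx : x ∈ A / A) (hy : y ∈ A / A) : x * y ∈ A / A := by
  have h' : #(A * A⁻¹) ≤ #A⁻¹ + 1 := by rwa [← div_eq_mul_inv, card_inv]
  have hx' : x⁻¹ ∈ A / A := by rwa [← mem_inv', inv_div]
  have h_card_x := card_le_card_inter_smul_add_one h' hx'
  have h_card_y := card_le_card_inter_smul_add_one h' hy
  rw [card_inv] at h_card_x h_card_y
  have h_union : #((A⁻¹ ∩ x⁻¹ • A⁻¹) ∪ (A⁻¹ ∩ y • A⁻¹)) ≤ #A := by
    rw [← card_inv A]
    exact card_le_card (union_subset inter_subset_left inter_subset_left)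
  have h_card := card_union_add_card_inter (A⁻¹ ∩ x⁻¹ • A⁻¹) (A⁻¹ ∩ y • A⁻¹)
  obtain ⟨u, hu⟩ : ((A⁻¹ ∩ x⁻¹ • A⁻¹) ∩ (A⁻¹ ∩ y • A⁻¹)).Nonempty := card_pos.1 (by lia)
  simp only [mem_inter, ← inv_smul_mem_iff, inv_inv, smul_eq_mul, mem_inv'] at hu
  refine mem_div.2 ⟨_, hu.2.2, _, hu.1.2, ?_⟩
  simp only [div_eq_mul_inv, mul_inv_rev, inv_inv]
  rw [mul_comm x u, mul_comm u⁻¹, mul_assoc, inv_mul_cancel_left, mul_comm]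

/-- If `A` and `B` have the same size `n ≥ 3` and `A * B` has at most `n + 1` elements, then some
subgroup has `n` or `n + 1` elements. -/
lemma exists_subgroup_card_of_card_mul_le (hn : 2 < n) (hA : #A = n) (hB : #B = n)
    (hAB : #(A * B) ≤ n + 1) : ∃ H : Subgroup G, Nat.card H = n ∨ Nat.card H = n + 1 := by
  have hA_ne : A.Nonempty := card_pos.1 (by lia)
  have h_le : #(A / A) ≤ #A + 1 := by
    rw [hA, ← hB]
    exact card_div_self_le hA_ne (by lia) (by lia)
  have h_ge : #A ≤ #(A / A) := card_le_card_div_self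
  let H : Subgroup G :=
    { carrier := (A / A : Finset G)
      one_mem' := mem_coe.2 <| one_mem_div_iff.2 fun h ↦ hA_ne.ne_empty (disjoint_self.1 h)
      mul_mem' := fun hx hy ↦ mul_mem_div_self (by lia) h_le hx hy
      inv_mem' := fun {x} hx ↦ by
        rwa [mem_coe, ← mem_inv', inv_div] }
  have hH : Nat.card H = #(A / A) := Nat.card_eq_finsetCard (A / A)
  refine ⟨H, ?_⟩
  rw [hH]
  lia

end SmallProductSets

theorem stmt_8 :
    ¬ ∃ (α β : Fin 5 → ZMod 17),
      (∀ i, α i ≠ 0) ∧ (∀ i, β i ≠ 0) ∧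
      Function.Injective α ∧ Function.Injective β ∧
      (Finset.univ.image fun ij : Fin 5 × Fin 5 => α ij.1 * β ij.2).card ≤ 6 := by
  rintro ⟨α, β, hα, hβ, hα_inj, hβ_inj, h_card⟩
  have : Fact (Nat.Prime 17) := ⟨by norm_num⟩
  lift α to Fin 5 → (ZMod 17)ˣ using fun i ↦ (hα i).isUnit
  lift β to Fin 5 → (ZMod 17)ˣ using fun i ↦ (hβ i).isUnit
  simp only [← Units.val_mul] at h_card
  obtain ⟨H, hH⟩ := exists_subgroup_card_of_card_mul_le (n := 5) (by norm_num)
    (Finset.card_map ⟨α, fun i j h ↦ hα_inj (congrArg Units.val h)⟩ (s := Finset.univ))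
    (Finset.card_map ⟨β, fun i j h ↦ hβ_inj (congrArg Units.val h)⟩ (s := Finset.univ)) <| by
      rw [← Finset.card_image_of_injective _ Units.val_injective]
      refine (Finset.card_le_card fun x hx ↦ ?_).trans h_card
      simp only [Finset.mem_image, Finset.mem_mul, Finset.mem_map] at hx ⊢
      obtain ⟨_, ⟨_, ⟨i, -, rfl⟩, _, ⟨j, -, rfl⟩, rfl⟩, rfl⟩ := hx
      exact ⟨(i, j), Finset.mem_univ _, rfl⟩
  have h_dvd := H.card_subgroup_dvd_card
  rw [Nat.card_eq_fintype_card (α := (ZMod 17)ˣ), ZMod.card_units] at h_dvd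
  rcases hH with hH | hH <;> rw [hH] at h_dvd <;> norm_num at h_dvd
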